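/- arXiv:2109.10511 — 5 statements merged into one kernel-verified Lean document; each statement's English description precedes it below -/
import Mathlib

section
/- For every n ∈ ℕ and every x ∈ (−2,2), the principal value 2·p.v.∫_{−2}^{2} Φ_n(y)/(x−y) dμ(y), i.e. the limit as ε → 0⁺ of 2·∫_{y ∈ [−2,2], |x−y| ≥ ε} Φ_n(y)/(x−y) · √(4−y²)/(2π) dy, exists and equals T_{n+1}(x). (In other words, the μ-Hilbert transform H_μ maps Φ_n to T_{n+1}.) -/
open MeasureTheory Filter

/-- Monic Chebyshev polynomials of the second kind on `[-2,2]`: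
`Φ₀ = 1`, `Φ₁(x) = x`, `Φ_{n+2}(x) = x Φ_{n+1}(x) - Φ_n(x)`. -/
noncomputable def PhiSC : ℕ → ℝ → ℝ
  | 0, _ => 1
  | 1, x => x
  | (n + 2), x => x * PhiSC (n + 1) x - PhiSC n x

/-- Monic Chebyshev polynomials of the first kind on `[-2,2]`:
`T₀ = 2`, `T₁(x) = x`, `T_{n+2}(x) = x T_{n+1}(x) - T_n(x)`. -/
noncomputable def TSC : ℕ → ℝ → ℝ
  | 0, _ => 2
  | 1, x => x
  | (n + 2), x => x * TSC (n + 1) x - TSC n x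

lemma phi_cont (n : ℕ) : Continuous (PhiSC n) := by
  induction n using Nat.twoStepInduction with
  | zero => exact (continuous_const : Continuous fun _ : ℝ => (1:ℝ)).congr (fun y => by simp [PhiSC])
  | one => exact continuous_id.congr (fun y => by simp [PhiSC])
  | more n h0 h1 =>
    exact ((continuous_id.mul h1).sub h0).congr (fun y => by simp [PhiSC])

lemma phi_sin (n : ℕ) (t : ℝ) :
    PhiSC n (2 * Real.cos t) * Real.sin t = Real.sin ((n + 1) * t) := by
  induction n using Nat.twoStepInduction with
  | zero => simp [PhiSC]
  | one =>
    simp only [PhiSC]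
    rw [show ((1:ℕ) + 1 : ℝ) * t = 2 * t by norm_num, Real.sin_two_mul]; ring
  | more n h0 h1 =>
    simp only [PhiSC]
    rw [sub_mul, h0, mul_assoc, h1]
    push_cast
    have e1 : ((n:ℝ) + 2 + 1) * t = (n + 1 + 1) * t + t := by ring
    have e0 : ((n:ℝ) + 1) * t = (n + 1 + 1) * t - t := by ring
    rw [e1, e0, Real.sin_add, Real.sin_sub]; ring

lemma int_cos (k : ℕ) : ∫ t in (0:ℝ)..Real.pi, Real.cos (((k:ℝ) + 1) * t) = 0 := by
  have hk : (k:ℝ) + 1 ≠ 0 := by positivity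
  rw [intervalIntegral.integral_comp_mul_left (fun t => Real.cos t) hk, integral_cos]
  have := Real.sin_nat_mul_pi (k + 1)
  push_cast at this
  simp [this]

lemma int_phi (n : ℕ) : ∫ y in (-2:ℝ)..2, PhiSC n y * Real.sqrt (4 - y ^ 2)
    = 2 * ∫ t in (0:ℝ)..Real.pi, (Real.cos (n * t) - Real.cos (((n + 1 : ℕ) + 1) * t)) := by
  have hg : Continuous fun y : ℝ => PhiSC n y * Real.sqrt (4 - y ^ 2) :=
    (phi_cont n).mul (by fun_prop)
  have h := intervalIntegral.integral_comp_mul_deriv (a := Real.pi) (b := 0)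
    (f := fun t => 2 * Real.cos t) (f' := fun t => 2 * (- Real.sin t))
    (g := fun y : ℝ => PhiSC n y * Real.sqrt (4 - y ^ 2))
    (fun t _ => (Real.hasDerivAt_cos t).const_mul 2) (by fun_prop) hg
  simp only [Real.cos_pi, Real.cos_zero, mul_one, mul_neg] at h
  rw [← h, intervalIntegral.integral_symm, ← intervalIntegral.integral_neg,
    ← intervalIntegral.integral_const_mul]
  apply intervalIntegral.integral_congr
  intro t ht
  rw [Set.uIcc_of_le Real.pi_pos.le] at ht
  have hs : 0 ≤ Real.sin t := Real.sin_nonneg_of_mem_Icc ht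
  have hq : Real.sqrt (4 - (2 * Real.cos t) ^ 2) = 2 * Real.sin t := by
    rw [show 4 - (2 * Real.cos t) ^ 2 = (2 * Real.sin t) ^ 2 by
      nlinarith [Real.sin_sq_add_cos_sq t]]
    exact Real.sqrt_sq (by positivity)
  have hp := phi_sin n t
  simp only [Function.comp]
  rw [hq]
  push_cast
  have e1 : ((n:ℝ) + 1 + 1) * t = (n + 1) * t + t := by ring
  have e0 : (n:ℝ) * t = (n + 1) * t - t := by ring
  rw [e1, e0, Real.cos_add, Real.cos_sub, ← hp]; ring

lemma int_phi_zero : ∫ y in (-2:ℝ)..2, PhiSC 0 y * Real.sqrt (4 - y ^ 2) = 2 * Real.pi := by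
  rw [int_phi, intervalIntegral.integral_sub
    (Continuous.intervalIntegrable (by fun_prop) _ _)
    (Continuous.intervalIntegrable (by fun_prop) _ _), int_cos]
  simp

lemma int_phi_succ (n : ℕ) : ∫ y in (-2:ℝ)..2, PhiSC (n+1) y * Real.sqrt (4 - y ^ 2) = 0 := by
  rw [int_phi, intervalIntegral.integral_sub
    (Continuous.intervalIntegrable (by fun_prop) _ _)
    (Continuous.intervalIntegrable (by fun_prop) _ _), int_cos]
  push_cast
  rw [int_cos]; simp

lemma ev_small (x : ℝ) (hx : x ∈ Set.Ioo (-2 : ℝ) 2) :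
    ∀ᶠ ε in nhdsWithin (0:ℝ) (Set.Ioi 0), 0 < ε ∧ -2 < x - ε ∧ x + ε < 2 := by
  have h1 : ∀ᶠ ε in nhdsWithin (0:ℝ) (Set.Ioi 0), ε < min (x + 2) (2 - x) :=
    mem_nhdsWithin_of_mem_nhds (Iio_mem_nhds (lt_min (by linarith [hx.1]) (by linarith [hx.2])))
  filter_upwards [h1, self_mem_nhdsWithin] with ε h h0
  have := lt_min_iff.1 h
  exact ⟨h0, by linarith, by linarith⟩

lemma split_int (x ε : ℝ) (h0 : 0 < ε) (h1 : -2 < x - ε) (h2 : x + ε < 2) (f : ℝ → ℝ)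
    (hf : ContinuousOn f (Set.Icc (-2 : ℝ) 2 \ Set.Ioo (x - ε) (x + ε))) :
    ∫ y in Set.Icc (-2 : ℝ) 2 \ Set.Ioo (x - ε) (x + ε), f y
      = (∫ y in (-2:ℝ)..(x - ε), f y) + ∫ y in (x + ε)..2, f y := by
  have e : Set.Icc (-2 : ℝ) 2 \ Set.Ioo (x - ε) (x + ε)
      = Set.Icc (-2) (x - ε) ∪ Set.Icc (x + ε) 2 := by
    ext y
    simp only [Set.mem_sdiff, Set.mem_Icc, Set.mem_Ioo, Set.mem_union, not_and, not_lt]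
    constructor
    · rintro ⟨⟨a, b⟩, c⟩
      by_cases h : x - ε < y
      · exact Or.inr ⟨c h, b⟩
      · exact Or.inl ⟨a, not_lt.1 h⟩
    · rintro (⟨a, b⟩ | ⟨a, b⟩)
      · exact ⟨⟨a, by linarith⟩, fun h => by linarith⟩
      · exact ⟨⟨by linarith, b⟩, fun h => by linarith⟩
  rw [e] at hf ⊢
  rw [setIntegral_union _ measurableSet_Icc, integral_Icc_eq_integral_Ioc,
    integral_Icc_eq_integral_Ioc, intervalIntegral.integral_of_le h1.le,
    intervalIntegral.integral_of_le h2.le]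
  · exact (hf.mono Set.subset_union_left).integrableOn_compact isCompact_Icc
  · exact (hf.mono Set.subset_union_right).integrableOn_compact isCompact_Icc
  · rw [Set.disjoint_left]
    rintro y ⟨_, a⟩ ⟨b, _⟩
    linarith

lemma lim_cont (x : ℝ) (hx : x ∈ Set.Ioo (-2 : ℝ) 2) (f : ℝ → ℝ) (hf : Continuous f) :
    Tendsto (fun ε : ℝ => ∫ y in Set.Icc (-2 : ℝ) 2 \ Set.Ioo (x - ε) (x + ε), f y)
      (nhdsWithin 0 (Set.Ioi 0)) (nhds (∫ y in (-2:ℝ)..2, f y)) := by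
  have hi : ∀ a b, IntervalIntegrable f volume a b := fun a b => hf.intervalIntegrable a b
  have hp : Continuous fun b => ∫ y in (-2:ℝ)..b, f y :=
    intervalIntegral.continuous_primitive (fun a b => hi a b) _
  have hc : Continuous fun ε : ℝ => (∫ y in (-2:ℝ)..(x - ε), f y) +
      ((∫ y in (-2:ℝ)..2, f y) - ∫ y in (-2:ℝ)..(x+ε), f y) :=
    (hp.comp (continuous_const.sub continuous_id)).add
      (continuous_const.sub (hp.comp (continuous_const.add continuous_id)))
  have ht := (hc.tendsto 0).mono_left (nhdsWithin_le_nhds (s := Set.Ioi (0:ℝ)))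
  simp only [sub_zero, add_zero, add_sub_cancel] at ht
  refine ht.congr' ?_
  filter_upwards [ev_small x hx] with ε ⟨h0, h1, h2⟩
  rw [split_int x ε h0 h1 h2 f hf.continuousOn,
    intervalIntegral.integral_interval_sub_left (hi _ _) (hi _ _)]

noncomputable def Nf (x y : ℝ) : ℝ := 4 - x * y + Real.sqrt (4 - x ^ 2) * Real.sqrt (4 - y ^ 2)

noncomputable def Ff (x y : ℝ) : ℝ :=
  x * Real.arcsin (y / 2) - Real.sqrt (4 - y ^ 2)
    + Real.sqrt (4 - x ^ 2) * (Real.log (Nf x y) - Real.log (x - y))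

lemma Nf_pos (x y : ℝ) (hx : x ∈ Set.Ioo (-2 : ℝ) 2) (hy : y ∈ Set.Icc (-2:ℝ) 2) : 0 < Nf x y := by
  have h : 0 < 4 - x * y := by
    have h1 : |x| < 2 := abs_lt.2 hx
    have h2 : |y| ≤ 2 := abs_le.2 hy
    have h3 : x * y ≤ |x| * |y| := by rw [← abs_mul]; exact le_abs_self _
    nlinarith [abs_nonneg x, abs_nonneg y]
  unfold Nf; positivity

lemma Ff_cont (x : ℝ) (hx : x ∈ Set.Ioo (-2 : ℝ) 2) (s : Set ℝ) (hs : s ⊆ Set.Icc (-2) 2)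
    (hxs : x ∉ s) : ContinuousOn (Ff x) s := by
  unfold Ff
  refine ContinuousOn.add (by fun_prop) (continuousOn_const.mul (ContinuousOn.sub ?_ ?_))
  · refine ContinuousOn.log ?_ (fun y hy => (Nf_pos x y hx (hs hy)).ne')
    unfold Nf; fun_prop
  · refine ContinuousOn.log (by fun_prop) (fun y hy h => hxs ?_)
    rwa [sub_eq_zero.1 h]

lemma Ff_deriv (x y : ℝ) (hx : x ∈ Set.Ioo (-2 : ℝ) 2) (hy : y ∈ Set.Ioo (-2:ℝ) 2) (hxy : x ≠ y) :
    HasDerivAt (Ff x) (Real.sqrt (4 - y ^ 2) / (x - y)) y := by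
  have hN := Nf_pos x y hx ⟨hy.1.le, hy.2.le⟩
  have hq : 0 < 4 - y ^ 2 := by nlinarith [hy.1, hy.2]
  have hq0 : 0 < 4 - x ^ 2 := by nlinarith [hx.1, hx.2]
  have hs := Real.sqrt_pos.2 hq
  have hs2 := Real.sq_sqrt hq.le
  have hs02 := Real.sq_sqrt hq0.le
  have hd : HasDerivAt (fun y : ℝ => Real.sqrt (4 - y ^ 2)) (-y / Real.sqrt (4 - y ^ 2)) y := by
    have h := HasDerivAt.sqrt (f := fun y : ℝ => 4 - y ^ 2) ((hasDerivAt_pow 2 y).const_sub 4) hq.ne'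
    have e : -(((2:ℕ):ℝ) * y ^ (2 - 1)) / (2 * Real.sqrt (4 - y ^ 2)) = -y / Real.sqrt (4 - y ^ 2) := by
      norm_num; field_simp
    rw [← e]; exact h
  have ha : HasDerivAt (fun y : ℝ => Real.arcsin (y / 2)) (1 / Real.sqrt (4 - y ^ 2)) y := by
    have h := (Real.hasDerivAt_arcsin (x := y / 2) (by linarith [hy.1]) (by linarith [hy.2])).comp y
      ((hasDerivAt_id y).div_const 2)
    have e : Real.sqrt (1 - (y / 2) ^ 2) = Real.sqrt (4 - y ^ 2) / 2 := by
      rw [show 1 - (y/2)^2 = (4 - y ^ 2) / 2 ^ 2 by ring, Real.sqrt_div hq.le,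
        Real.sqrt_sq (by norm_num)]
    have e2 : 1 / Real.sqrt (1 - (y / 2) ^ 2) * (1 / 2) = 1 / Real.sqrt (4 - y ^ 2) := by
      rw [e]; field_simp
    rw [← e2]; exact h
  have hNd : HasDerivAt (Nf x) (-x + Real.sqrt (4 - x ^ 2) * (-y / Real.sqrt (4 - y ^ 2))) y := by
    have h := (((hasDerivAt_id y).const_mul x).const_sub 4).add (hd.const_mul (Real.sqrt (4 - x ^ 2)))
    rw [mul_one] at h; exact h
  have hxy' : x - y ≠ 0 := sub_ne_zero.2 hxy
  have h := ((ha.const_mul x).sub hd).add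
    (((hNd.log hN.ne').sub (((hasDerivAt_id y).const_sub x).log hxy')).const_mul (Real.sqrt (4 - x ^ 2)))
  refine HasDerivAt.congr_deriv h ?_
  simp only [id]
  have hN' := hN.ne'
  have key : (-x + Real.sqrt (4 - x ^ 2) * (-y / Real.sqrt (4 - y ^ 2))) / Nf x y - -1 / (x - y)
      = Real.sqrt (4 - x ^ 2) / (Real.sqrt (4 - y ^ 2) * (x - y)) := by
    have hNe : Nf x y = 4 - x * y + Real.sqrt (4 - x ^ 2) * Real.sqrt (4 - y ^ 2) := rfl
    generalize Real.sqrt (4 - y ^ 2) = s at *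
    generalize Real.sqrt (4 - x ^ 2) = s0 at *
    generalize Nf x y = N at *
    field_simp
    subst hNe
    linear_combination (-s) * hs02 + s0 * hs2
  rw [key]
  generalize Real.sqrt (4 - y ^ 2) = s at *
  generalize Real.sqrt (4 - x ^ 2) = s0 at *
  field_simp
  linear_combination hs02 - hs2

lemma Ff_int (x a b : ℝ) (hx : x ∈ Set.Ioo (-2 : ℝ) 2) (hab : a ≤ b) (ha : -2 ≤ a) (hb : b ≤ 2)
    (hxs : x ∉ Set.Icc a b) :
    ∫ y in a..b, Real.sqrt (4 - y ^ 2) / (x - y) = Ff x b - Ff x a := by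
  refine intervalIntegral.integral_eq_sub_of_hasDerivAt_of_le hab
    (Ff_cont x hx _ (Set.Icc_subset_Icc ha hb) hxs) ?_ ?_
  · intro y hy
    exact Ff_deriv x y hx ⟨by linarith [hy.1], by linarith [hy.2]⟩
      (fun h => hxs (h ▸ ⟨hy.1.le, hy.2.le⟩))
  · apply ContinuousOn.intervalIntegrable
    rw [Set.uIcc_of_le hab]
    exact ContinuousOn.div (by fun_prop) (by fun_prop)
      (fun y hy h => hxs (by rwa [sub_eq_zero.1 h]))

lemma Ff_ends (x : ℝ) (hx : x ∈ Set.Ioo (-2 : ℝ) 2) : Ff x 2 - Ff x (-2) = Real.pi * x := by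
  have h1 : x - 2 = -(2 - x) := by ring
  have h2 : x - -2 = 2 + x := by ring
  have h3 : Nf x 2 = 2 * (2 - x) := by unfold Nf; norm_num; ring
  have h4 : Nf x (-2) = 2 * (2 + x) := by unfold Nf; norm_num; ring
  have h5 : 2 - x ≠ 0 := by linarith [hx.2]
  have h6 : 2 + x ≠ 0 := by linarith [hx.1]
  unfold Ff
  rw [h1, h2, h3, h4, Real.log_neg_eq_log, Real.log_mul two_ne_zero h5, Real.log_mul two_ne_zero h6]
  norm_num
  ring

lemma cont_int (n : ℕ) (x ε : ℝ) (h0 : 0 < ε) :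
    ContinuousOn (fun y => PhiSC n y / (x - y) * (Real.sqrt (4 - y ^ 2) / (2 * Real.pi)))
      (Set.Icc (-2 : ℝ) 2 \ Set.Ioo (x - ε) (x + ε)) := by
  refine ContinuousOn.mul (ContinuousOn.div (phi_cont n).continuousOn (by fun_prop) ?_) (by fun_prop)
  intro y hy h
  apply hy.2
  constructor <;> linarith

lemma base (x : ℝ) (hx : x ∈ Set.Ioo (-2 : ℝ) 2) :
    Tendsto
      (fun ε : ℝ =>
        2 * ∫ y in Set.Icc (-2 : ℝ) 2 \ Set.Ioo (x - ε) (x + ε),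
          PhiSC 0 y / (x - y) * (Real.sqrt (4 - y ^ 2) / (2 * Real.pi)))
      (nhdsWithin 0 (Set.Ioi 0)) (nhds x) := by
  have hA : ContinuousAt (fun y => x * Real.arcsin (y / 2) - Real.sqrt (4 - y ^ 2)
      + Real.sqrt (4 - x ^ 2) * Real.log (Nf x y)) x := by
    refine ContinuousAt.add (by fun_prop) (continuousAt_const.mul (ContinuousAt.log ?_
      (Nf_pos x x hx ⟨hx.1.le, hx.2.le⟩).ne'))
    unfold Nf; fun_prop
  set A : ℝ → ℝ := fun y => x * Real.arcsin (y / 2) - Real.sqrt (4 - y ^ 2)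
      + Real.sqrt (4 - x ^ 2) * Real.log (Nf x y) with hAdef
  have t1 : Tendsto (fun ε : ℝ => A (x - ε)) (nhds 0) (nhds (A x)) := by
    refine hA.tendsto.comp ?_
    have : Continuous fun ε : ℝ => x - ε := by fun_prop
    simpa using this.tendsto 0
  have t2 : Tendsto (fun ε : ℝ => A (x + ε)) (nhds 0) (nhds (A x)) := by
    refine hA.tendsto.comp ?_
    have : Continuous fun ε : ℝ => x + ε := by fun_prop
    simpa using this.tendsto 0
  have t : Tendsto (fun ε : ℝ => (Real.pi * x + (A (x - ε) - A (x + ε))) / Real.pi)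
      (nhdsWithin 0 (Set.Ioi 0)) (nhds x) := by
    have := (((t1.sub t2).const_add (Real.pi * x)).div_const Real.pi).mono_left
      (nhdsWithin_le_nhds (s := Set.Ioi (0:ℝ)))
    have e : (Real.pi * x + (A x - A x)) / Real.pi = x := by
      field_simp [Real.pi_pos.ne']; ring
    rwa [e] at this
  refine t.congr' ?_
  filter_upwards [ev_small x hx] with ε ⟨h0, h1, h2⟩
  rw [split_int x ε h0 h1 h2 _ (cont_int 0 x ε h0)]
  have e : ∀ y, PhiSC 0 y / (x - y) * (Real.sqrt (4 - y ^ 2) / (2 * Real.pi))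
      = (Real.sqrt (4 - y ^ 2) / (x - y)) * (1 / (2 * Real.pi)) := by
    intro y; simp only [PhiSC]; ring
  simp only [e, intervalIntegral.integral_mul_const]
  rw [Ff_int x _ _ hx h1.le le_rfl (by linarith [hx.2]) (fun h => by linarith [h.2]),
    Ff_int x _ _ hx h2.le (by linarith [hx.1]) le_rfl (fun h => by linarith [h.1])]
  have hF : Ff x (x - ε) - Ff x (x + ε) = A (x - ε) - A (x + ε) := by
    simp only [Ff, hAdef]
    rw [show x - (x - ε) = ε by ring, show x - (x + ε) = -ε by ring, Real.log_neg_eq_log]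
    ring
  rw [← hF, ← Ff_ends x hx]
  field_simp
  ring

lemma rec_int (x ε : ℝ) (h0 : 0 < ε) (f g h : ℝ → ℝ) (c : ℝ)
    (S : Set ℝ) (hS : MeasurableSet S)
    (hf : IntegrableOn f S) (hg : IntegrableOn g S) (hh : IntegrableOn h S) (F : ℝ → ℝ)
    (hF : ∀ y ∈ S, F y = c * f y - g y - h y) :
    ∫ y in S, F y = c * (∫ y in S, f y) - (∫ y in S, g y) - ∫ y in S, h y := by
  rw [setIntegral_congr_fun hS hF,
    integral_sub (f := fun y => c * f y - g y) ((hf.const_mul c).sub hg) hh,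
    integral_sub (hf.const_mul c) hg, integral_const_mul]

/-- for every `n` and every `x ∈ (-2,2)`, the principal value
`2 p.v.∫_{-2}^{2} Φₙ(y)/(x-y) dμ(y)` (with `μ` the standard semicircle measure) exists
and equals `T_{n+1}(x)`, i.e. the `μ`-Hilbert transform maps `Φₙ` to `T_{n+1}`. -/
theorem statement_2 (n : ℕ) (x : ℝ) (hx : x ∈ Set.Ioo (-2 : ℝ) 2) :
    Tendsto
      (fun ε : ℝ =>
        2 * ∫ y in Set.Icc (-2 : ℝ) 2 \ Set.Ioo (x - ε) (x + ε),
          PhiSC n y / (x - y) * (Real.sqrt (4 - y ^ 2) / (2 * Real.pi)))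
      (nhdsWithin 0 (Set.Ioi 0)) (nhds (TSC (n + 1) x)) := by
  have hgc : ∀ n, Continuous fun y => PhiSC n y * Real.sqrt (4 - y ^ 2) * (1 / (2 * Real.pi)) :=
    fun n => ((phi_cont n).mul (by fun_prop)).mul continuous_const
  have hl := fun n => lim_cont x hx _ (hgc n)
  simp only [intervalIntegral.integral_mul_const] at hl
  have hcS : ∀ ε, IsCompact (Set.Icc (-2 : ℝ) 2 \ Set.Ioo (x - ε) (x + ε)) :=
    fun ε => isCompact_Icc.diff isOpen_Ioo
  have hI := fun n ε h0 => (cont_int n x ε h0).integrableOn_compact (μ := volume) (hcS ε)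
  have hG := fun n ε => (hgc n).continuousOn.integrableOn_compact (μ := volume) (hcS ε)
  have hpi := Real.pi_pos
  induction n using Nat.twoStepInduction with
  | zero => simpa [TSC] using base x hx
  | one =>
    have t := ((base x hx).const_mul x).sub ((hl 0).const_mul 2)
    rw [int_phi_zero] at t
    have e : x * x - 2 * (2 * Real.pi * (1 / (2 * Real.pi))) = TSC (1 + 1) x := by
      simp only [TSC]; field_simp
    rw [e] at t
    refine t.congr' ?_
    filter_upwards [ev_small x hx] with ε ⟨h0, h1, h2⟩
    rw [rec_int x ε h0 _ _ (fun _ => 0) x _ (hcS ε).measurableSet (hI 0 ε h0) (hG 0 ε)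
      (by simp) (fun y => PhiSC 1 y / (x - y) * (Real.sqrt (4 - y ^ 2) / (2 * Real.pi))) ?_]
    · simp; ring
    · intro y hy
      have : x - y ≠ 0 := fun h => hy.2 (by constructor <;> linarith)
      simp only [PhiSC]; field_simp; ring
  | more n ih0 ih1 =>
    have t := ((ih1.const_mul x).sub ((hl (n+1)).const_mul 2)).sub ih0
    rw [int_phi_succ] at t
    have e : x * TSC (n + 1 + 1) x - 2 * (0 * (1 / (2 * Real.pi))) - TSC (n + 1) x
        = TSC (n + 2 + 1) x := by
      simp [TSC]
    rw [e] at t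
    refine t.congr' ?_
    filter_upwards [ev_small x hx] with ε ⟨h0, h1, h2⟩
    rw [rec_int x ε h0 _ _ _ x _ (hcS ε).measurableSet (hI (n+1) ε h0) (hG (n+1) ε)
      (hI n ε h0) (fun y => PhiSC (n+2) y / (x - y) * (Real.sqrt (4 - y ^ 2) / (2 * Real.pi))) ?_]
    · ring
    · intro y hy
      have : x - y ≠ 0 := fun h => hy.2 (by constructor <;> linarith)
      simp only [PhiSC]; field_simp; ring
end

section
/- For all m,n ∈ ℕ and t ∈ ℂ: I_{m,n}(t) = (−1)^m I_{0,m+n}(t) = (−1)^n I_{m+n,0}(t); moreover I_{0,n}(t) = J_{n+2}(2t) + J_n(2t) for all t, and I_{0,n}(t) = (n+1)·J_{n+1}(2t)/t for t ≠ 0. -/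
/-- The coefficients
`I_{m,n}(t) = Σ_{p≥0} (-1)^{p+m} t^{m+n+2p}/(m+n+2p)! · (m+n+1)/(2p+m+n+1) · C(2p+m+n+1, p)`. -/
noncomputable def Icoef (m n : ℕ) (t : ℂ) : ℂ :=
  ∑' p : ℕ, (-1) ^ (p + m) * t ^ (m + n + 2 * p) / (Nat.factorial (m + n + 2 * p) : ℂ) *
    (((m : ℂ) + n + 1) / (2 * (p : ℂ) + m + n + 1)) * (Nat.choose (2 * p + m + n + 1) p : ℂ)

/-- Bessel function of the first kind of integer order `n`:
`J_n(z) = Σ_{p≥0} (-1)^p/(p!(n+p)!) (z/2)^{n+2p}`. -/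
noncomputable def besselJ (n : ℕ) (z : ℂ) : ℂ :=
  ∑' p : ℕ, ((-1) ^ p / ((Nat.factorial p : ℂ) * (Nat.factorial (n + p) : ℂ))) *
    (z / 2) ^ (n + 2 * p)

theorem Icoef_term (m n p : ℕ) (t : ℂ) :
    (-1) ^ (p + m) * t ^ (m + n + 2 * p) / (Nat.factorial (m + n + 2 * p) : ℂ) *
    (((m : ℂ) + n + 1) / (2 * (p : ℂ) + m + n + 1)) * (Nat.choose (2 * p + m + n + 1) p : ℂ)
    = (-1) ^ (p + m) * t ^ (m + n + 2 * p) * ((m : ℂ) + n + 1) /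
      ((Nat.factorial p : ℂ) * (Nat.factorial (m + n + 1 + p) : ℂ)) := by
  have h := Nat.choose_mul_factorial_mul_factorial (n := 2 * p + m + n + 1) (k := p) (by omega)
  have e1 : 2 * p + m + n + 1 - p = m + n + 1 + p := by omega
  have e2 : Nat.factorial (2 * p + m + n + 1) =
      (2 * p + m + n + 1) * Nat.factorial (m + n + 2 * p) := by
    rw [Nat.factorial_succ]
    congr 2
    omega
  rw [e1, e2] at h
  have h' : (Nat.choose (2 * p + m + n + 1) p : ℂ) * (Nat.factorial p : ℂ) *
      (Nat.factorial (m + n + 1 + p) : ℂ) =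
      (2 * (p : ℂ) + m + n + 1) * (Nat.factorial (m + n + 2 * p) : ℂ) := by exact_mod_cast h
  have h1 : (Nat.factorial p : ℂ) ≠ 0 := by exact_mod_cast Nat.factorial_ne_zero _
  have h2 : (Nat.factorial (m + n + 1 + p) : ℂ) ≠ 0 := by exact_mod_cast Nat.factorial_ne_zero _
  have h3 : (Nat.factorial (m + n + 2 * p) : ℂ) ≠ 0 := by exact_mod_cast Nat.factorial_ne_zero _
  have h4 : (2 * (p : ℂ) + m + n + 1) ≠ 0 := by
    have : ((2 * p + m + n + 1 : ℕ) : ℂ) ≠ 0 := Nat.cast_ne_zero.2 (Nat.succ_ne_zero _)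
    exact_mod_cast this
  rw [div_mul_div_comm, div_mul_eq_mul_div, div_eq_div_iff (mul_ne_zero h3 h4) (mul_ne_zero h1 h2)]
  linear_combination ((-1) ^ (p + m) * t ^ (m + n + 2 * p) * ((m : ℂ) + n + 1)) * h'

theorem Icoef_eq (m n : ℕ) (t : ℂ) : Icoef m n t = ∑' p : ℕ,
    (-1) ^ (p + m) * t ^ (m + n + 2 * p) * ((m : ℂ) + n + 1) /
      ((Nat.factorial p : ℂ) * (Nat.factorial (m + n + 1 + p) : ℂ)) :=
  tsum_congr fun p => Icoef_term m n p t

theorem bessel_summable (n : ℕ) (z : ℂ) : Summable fun p : ℕ =>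
    ((-1) ^ p / ((Nat.factorial p : ℂ) * (Nat.factorial (n + p) : ℂ))) * (z / 2) ^ (n + 2 * p) := by
  refine Summable.of_norm_bounded
    (g := fun p : ℕ => ‖z / 2‖ ^ n * ((‖z / 2‖ ^ 2) ^ p / (Nat.factorial p : ℝ)))
    ((Real.summable_pow_div_factorial _).mul_left _) ?_
  intro p
  rw [norm_mul, norm_div, norm_pow, norm_pow, norm_neg, norm_one, one_pow, norm_mul,
    Complex.norm_natCast, Complex.norm_natCast, pow_add, pow_mul]
  have h1 : (1 : ℝ) ≤ (Nat.factorial (n + p) : ℝ) := by exact_mod_cast Nat.factorial_pos _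
  have h2 : (0 : ℝ) < (Nat.factorial p : ℝ) := by exact_mod_cast Nat.factorial_pos _
  have h3 : 1 / ((Nat.factorial p : ℝ) * (Nat.factorial (n + p) : ℝ)) ≤ 1 / (Nat.factorial p : ℝ) :=
    one_div_le_one_div_of_le h2 (le_mul_of_one_le_right h2.le h1)
  calc _ ≤ 1 / (Nat.factorial p : ℝ) * (‖z / 2‖ ^ n * (‖z / 2‖ ^ 2) ^ p) :=
        mul_le_mul_of_nonneg_right h3 (by positivity)
    _ = _ := by ring

theorem Icoef_symm (m n : ℕ) (t : ℂ) : Icoef m n t = (-1) ^ m * Icoef 0 (m + n) t := by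
  rw [Icoef_eq, Icoef_eq, ← tsum_mul_left]
  refine tsum_congr fun p => ?_
  simp only [zero_add, add_zero, Nat.cast_zero, Nat.cast_add]
  ring

/-- `I_{m,n}(t) = (-1)^m I_{0,m+n}(t) = (-1)^n I_{m+n,0}(t)`,
`I_{0,n}(t) = J_{n+2}(2t) + J_n(2t)`, and `I_{0,n}(t) = (n+1) J_{n+1}(2t)/t` for `t ≠ 0`. -/
theorem statement_5 (m n : ℕ) (t : ℂ) :
    Icoef m n t = (-1) ^ m * Icoef 0 (m + n) t ∧
    Icoef m n t = (-1) ^ n * Icoef (m + n) 0 t ∧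
    Icoef 0 n t = besselJ (n + 2) (2 * t) + besselJ n (2 * t) ∧
    (t ≠ 0 → Icoef 0 n t = ((n : ℂ) + 1) * besselJ (n + 1) (2 * t) / t) := by
  have hz : 2 * t / 2 = t := by ring
  refine ⟨Icoef_symm m n t, ?_, ?_, ?_⟩
  · rw [Icoef_symm m n, Icoef_symm (m + n) 0, ← mul_assoc, add_zero, pow_add,
      mul_left_comm, ← mul_pow]
    simp
  · have hf := bessel_summable n (2 * t)
    have hg := bessel_summable (n + 2) (2 * t)
    have key : ∀ p : ℕ, (-1) ^ (p + 1 + 0) * t ^ (0 + n + 2 * (p + 1)) * (((0 : ℕ) : ℂ) + n + 1) /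
        ((Nat.factorial (p + 1) : ℂ) * (Nat.factorial (0 + n + 1 + (p + 1)) : ℂ)) =
        ((-1) ^ p / ((Nat.factorial p : ℂ) * (Nat.factorial (n + 2 + p) : ℂ))) *
          (2 * t / 2) ^ (n + 2 + 2 * p) +
        ((-1) ^ (p + 1) / ((Nat.factorial (p + 1) : ℂ) * (Nat.factorial (n + (p + 1)) : ℂ))) *
          (2 * t / 2) ^ (n + 2 * (p + 1)) := by
      intro p
      rw [hz, show 0 + n + 1 + (p + 1) = n + p + 1 + 1 by ring, show n + 2 + p = n + p + 1 + 1 by ring,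
        show n + (p + 1) = n + p + 1 by ring, Nat.factorial_succ (n + p + 1), Nat.factorial_succ p]
      have h1 : (Nat.factorial p : ℂ) ≠ 0 := by exact_mod_cast Nat.factorial_ne_zero _
      have h2 : (Nat.factorial (n + p + 1) : ℂ) ≠ 0 := by exact_mod_cast Nat.factorial_ne_zero _
      have h3 : (p : ℂ) + 1 ≠ 0 := Nat.cast_add_one_ne_zero p
      have h4 : (n : ℂ) + p + 1 + 1 ≠ 0 := by norm_cast; try omega
      push_cast
      field_simp
      ring
    have hf' := (summable_nat_add_iff 1).2 hf
    rw [Icoef_eq, besselJ, besselJ, hf.tsum_eq_zero_add, Summable.tsum_eq_zero_add]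
    · rw [tsum_congr key, hg.tsum_add hf', hz]
      have h2 : (Nat.factorial n : ℂ) ≠ 0 := by exact_mod_cast Nat.factorial_ne_zero _
      have h3 : (n : ℂ) + 1 ≠ 0 := Nat.cast_add_one_ne_zero n
      have h0 : (-1) ^ (0 + 0) * t ^ (0 + n + 2 * 0) * (((0 : ℕ) : ℂ) + n + 1) /
        ((Nat.factorial 0 : ℂ) * (Nat.factorial (0 + n + 1 + 0) : ℂ)) =
        ((-1) ^ 0 / ((Nat.factorial 0 : ℂ) * (Nat.factorial (n + 0) : ℂ))) *
          t ^ (n + 2 * 0) := by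
        simp only [zero_add, add_zero, mul_zero, Nat.factorial_succ, Nat.factorial_zero]
        push_cast
        field_simp
        ring
      rw [h0]
      ring
    · rw [← summable_nat_add_iff 1]
      exact (hg.add hf').congr fun p => (key p).symm
  · intro ht
    rw [Icoef_eq, besselJ, ← tsum_mul_left, ← tsum_div_const]
    refine tsum_congr fun p => ?_
    rw [hz, show 0 + n + 1 + p = n + 1 + p by ring, show n + 1 + 2 * p = (0 + n + 2 * p) + 1 by ring,
      pow_succ]
    have h1 : (Nat.factorial p : ℂ) ≠ 0 := by exact_mod_cast Nat.factorial_ne_zero _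
    have h2 : (Nat.factorial (n + 1 + p) : ℂ) ≠ 0 := by exact_mod_cast Nat.factorial_ne_zero _
    simp only [Nat.cast_zero, zero_add, add_zero]
    field_simp
end

section
/- For every real t ≠ 0, the characteristic function of the standard semicircle distribution equals J₁(2t)/t: ∫_{−2}^{2} e^{itx} · √(4−x²)/(2π) dx = J₁(2t)/t. -/
/-- the moments of cosine on `[0,π]` -/
theorem aux_cos_rec (n : ℕ) : (∫ x in (0:ℝ)..Real.pi, Real.cos x ^ (n+2)) =
    (n+1)/(n+2) * ∫ x in (0:ℝ)..Real.pi, Real.cos x ^ n := by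
  rw [integral_cos_pow]; simp

theorem aux_cos_odd (p : ℕ) : (∫ x in (0:ℝ)..Real.pi, Real.cos x ^ (2*p+1)) = 0 := by
  induction p with
  | zero => simp
  | succ p ih =>
    rw [show 2*(p+1)+1 = (2*p+1)+2 by ring, aux_cos_rec, ih, mul_zero]

theorem aux_cos_even (p : ℕ) : (∫ x in (0:ℝ)..Real.pi, Real.cos x ^ (2*p)) =
    Real.pi * (2*p).factorial / (4^p * (p.factorial)^2) := by
  induction p with
  | zero => simp
  | succ p ih =>
    rw [show 2*(p+1) = (2*p)+2 by ring, aux_cos_rec, ih]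
    simp only [Nat.factorial_succ]
    push_cast
    have : (p.factorial : ℝ) ≠ 0 := by positivity
    have : (p + 1 : ℝ) ≠ 0 := by positivity
    field_simp
    ring

theorem aux_mom (k : ℕ) : (∫ x in (0:ℝ)..Real.pi, Real.cos x ^ k * Real.sin x ^ 2) =
    (∫ x in (0:ℝ)..Real.pi, Real.cos x ^ k) / (k+2) := by
  have h : ∀ x, Real.cos x ^ k * Real.sin x ^ 2 = Real.cos x ^ k - Real.cos x ^ (k+2) := by
    intro x; rw [Real.sin_sq]; ring
  simp_rw [h]
  rw [intervalIntegral.integral_sub (Continuous.intervalIntegrable (by fun_prop) _ _)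
    (Continuous.intervalIntegrable (by fun_prop) _ _), aux_cos_rec]
  have : (k + 2 : ℝ) ≠ 0 := by positivity
  field_simp
  ring

theorem aux_subst (t : ℝ) :
    (∫ x in (-2 : ℝ)..2,
        Complex.exp (Complex.I * t * x) * ((Real.sqrt (4 - x ^ 2) / (2 * Real.pi) : ℝ) : ℂ)) =
    ∫ x in (0:ℝ)..Real.pi, Complex.exp (Complex.I * t * (2 * Real.cos x)) *
      ((2 / Real.pi * Real.sin x ^ 2 : ℝ) : ℂ) := by
  have h := intervalIntegral.integral_comp_smul_deriv (a := 0) (b := Real.pi)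
    (f := fun x => 2 * Real.cos x) (f' := fun x => 2 * (-Real.sin x))
    (g := fun x : ℝ => Complex.exp (Complex.I * t * x) *
      ((Real.sqrt (4 - x ^ 2) / (2 * Real.pi) : ℝ) : ℂ))
    (fun x _ => (Real.hasDerivAt_cos x).const_mul 2) (by fun_prop) (by fun_prop)
  simp only [Real.cos_zero, Real.cos_pi, mul_one, mul_neg] at h
  rw [intervalIntegral.integral_symm, ← h, ← intervalIntegral.integral_neg]
  apply intervalIntegral.integral_congr
  intro x hx
  rw [Set.uIcc_of_le Real.pi_pos.le] at hx
  have hs := Real.sin_nonneg_of_mem_Icc hx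
  have : Real.sqrt (4 - (2 * Real.cos x)^2) = 2 * Real.sin x := by
    rw [show 4 - (2 * Real.cos x)^2 = (2 * Real.sin x)^2 by rw [mul_pow, mul_pow, Real.sin_sq]; ring]
    exact Real.sqrt_sq (by positivity)
  simp only [Function.comp, this, Complex.real_smul]
  push_cast
  have : (Real.pi : ℂ) ≠ 0 := by exact_mod_cast Real.pi_ne_zero
  field_simp

theorem aux_hasSum (t : ℝ) :
    HasSum (fun k : ℕ => ∫ x in (0:ℝ)..Real.pi,
      (Complex.I * t * (2 * Real.cos x)) ^ k / (k.factorial : ℂ) *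
      ((2 / Real.pi * Real.sin x ^ 2 : ℝ) : ℂ))
    (∫ x in (0:ℝ)..Real.pi, Complex.exp (Complex.I * t * (2 * Real.cos x)) *
      ((2 / Real.pi * Real.sin x ^ 2 : ℝ) : ℂ)) := by
  apply intervalIntegral.hasSum_integral_of_dominated_convergence
    (fun k _ => (2 * |t|)^k / k.factorial * (2 / Real.pi))
  · intro k
    exact Continuous.aestronglyMeasurable (by fun_prop)
  · intro k
    refine Filter.Eventually.of_forall fun x _ => ?_
    simp only [norm_mul, norm_div, norm_pow, Complex.norm_I, Complex.norm_real, Complex.norm_natCast,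
      Real.norm_eq_abs, one_mul, Complex.norm_ofNat, abs_of_pos Real.pi_pos, abs_two]
    have h1 : |t| * (2 * |Real.cos x|) ≤ 2 * |t| := by
      nlinarith [Real.abs_cos_le_one x, abs_nonneg t]
    have h2 : |Real.sin x| ^ 2 ≤ 1 := pow_le_one₀ (abs_nonneg _) (Real.abs_sin_le_one x)
    have h3 : 2 / Real.pi * |Real.sin x| ^ 2 ≤ 2 / Real.pi :=
      mul_le_of_le_one_right (by positivity) h2
    gcongr
  · refine Filter.Eventually.of_forall fun x _ => ?_
    exact (Real.summable_pow_div_factorial _).mul_right _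
  · simp
  · refine Filter.Eventually.of_forall fun x _ => ?_
    apply HasSum.mul_right
    rw [Complex.exp_eq_exp_ℂ]
    exact NormedSpace.expSeries_div_hasSum_exp _

theorem aux_term (t : ℝ) (k : ℕ) : (∫ x in (0:ℝ)..Real.pi,
      (Complex.I * t * (2 * Real.cos x)) ^ k / (k.factorial : ℂ) *
      ((2 / Real.pi * Real.sin x ^ 2 : ℝ) : ℂ)) =
    (Complex.I * t * 2)^k / (k.factorial : ℂ) * (2 / Real.pi) *
      (((∫ x in (0:ℝ)..Real.pi, Real.cos x ^ k) / (k+2) : ℝ) : ℂ) := by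
  rw [← aux_mom, ← intervalIntegral.integral_ofReal, ← intervalIntegral.integral_const_mul]
  congr 1
  ext x
  push_cast
  ring

theorem statement_9 (t : ℝ) (ht : t ≠ 0) :
    (∫ x in (-2 : ℝ)..2,
        Complex.exp (Complex.I * t * x) * ((Real.sqrt (4 - x ^ 2) / (2 * Real.pi) : ℝ) : ℂ)) =
      besselJ 1 (2 * t) / t := by
  have h := aux_hasSum t
  rw [← aux_subst] at h
  simp_rw [aux_term] at h
  have hi : Function.Injective (fun p : ℕ => 2 * p) := fun a b h => by simpa using h
  rw [← hi.hasSum_iff] at h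
  · rw [← h.tsum_eq, besselJ, ← tsum_div_const]
    congr 1
    ext p
    have htc : (t : ℂ) ≠ 0 := by exact_mod_cast ht
    have hpi : (Real.pi : ℂ) ≠ 0 := by exact_mod_cast Real.pi_ne_zero
    have h1 : (p.factorial : ℂ) ≠ 0 := by exact_mod_cast p.factorial_ne_zero
    have h2 : ((2*p).factorial : ℂ) ≠ 0 := by exact_mod_cast (2*p).factorial_ne_zero
    have h3 : (p + 1 : ℂ) ≠ 0 := by exact_mod_cast p.succ_ne_zero
    have h4 : (2 * p + 2 : ℂ) ≠ 0 := by exact_mod_cast (2*p+1).succ_ne_zero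
    simp only [Function.comp, aux_cos_even]
    rw [add_comm 1 p, Nat.factorial_succ, mul_div_cancel_left₀ _ (two_ne_zero), mul_pow, mul_pow,
      pow_mul Complex.I, Complex.I_sq, pow_mul 2, pow_add, pow_one]
    push_cast
    norm_num only
    have h5 : (4 : ℂ)^p ≠ 0 := pow_ne_zero _ (by norm_num)
    field_simp
  · intro k hk
    rcases Nat.even_or_odd' k with ⟨p, rfl | rfl⟩
    · exact absurd ⟨p, rfl⟩ hk
    · rw [aux_cos_odd]; simp
end

section
/- For every real t and every θ ∈ (0,π): Σ_{m≥1} (−1)^m J_m(2t) sin(mθ) = −sin(2t·sinθ)/2 − (sinθ/(2π)) · p.v.∫₀^π cos(2t·sinφ)/(cosθ − cosφ) dφ, where the principal value integral is the limit as ε → 0⁺ of the integral over [0,π] ∖ (θ−ε, θ+ε). -/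
open MeasureTheory Filter

/-- Bessel function of the first kind of integer order `n` (real variable):
`J_n(x) = Σ_{p≥0} (-1)^p/(p!(n+p)!) (x/2)^{n+2p}`. -/
noncomputable def besselJR (n : ℕ) (x : ℝ) : ℝ :=
  ∑' p : ℕ, ((-1) ^ p / ((Nat.factorial p : ℝ) * (Nat.factorial (n + p) : ℝ))) *
    (x / 2) ^ (n + 2 * p)

lemma hs_congrR {f g : ℕ → ℝ} {a : ℝ} (h : ∀ n, f n = g n) (hs : HasSum f a) : HasSum g a := by
  rwa [← funext h]

lemma hs_congrC {f g : ℕ → ℂ} {a : ℂ} (h : ∀ n, f n = g n) (hs : HasSum f a) : HasSum g a := by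
  rwa [← funext h]

open Complex in
lemma exp_hs (x : ℂ) : HasSum (fun n : ℕ => x ^ n / (n.factorial : ℂ)) (Complex.exp x) := by
  rw [Complex.exp_eq_exp_ℂ]; exact NormedSpace.expSeries_div_hasSum_exp x

def zEquiv : ℤ × ℕ ≃ ℕ × ℕ where
  toFun q := (q.2 + q.1.toNat, q.2 + (-q.1).toNat)
  invFun q := ((q.1 : ℤ) - q.2, min q.1 q.2)
  left_inv := by rintro ⟨n, p⟩; ext <;> simp <;> omega
  right_inv := by rintro ⟨n, p⟩; ext <;> simp <;> omega

lemma term_bound (n p : ℕ) (t : ℝ) :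
    ‖((-1) ^ p / ((Nat.factorial p : ℝ) * (Nat.factorial (n + p) : ℝ))) *
    (2 * t / 2) ^ (n + 2 * p)‖ ≤ |t| ^ n / n.factorial * ((t ^ 2) ^ p / p.factorial) := by
  have h : 2 * t / 2 = t := by ring
  rw [h, norm_mul, norm_div, norm_pow, norm_neg, norm_one, one_pow, norm_mul, norm_pow,
    Real.norm_natCast, Real.norm_natCast, Real.norm_eq_abs, pow_add, pow_mul, sq_abs]
  have h1 : (n.factorial : ℝ) ≤ (n + p).factorial := by
    exact_mod_cast Nat.factorial_le (Nat.le_add_right n p)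
  have h2 : (0 : ℝ) < n.factorial := by positivity
  have h3 : (0 : ℝ) < p.factorial := by positivity
  calc _ = |t| ^ n * (t ^ 2) ^ p / (p.factorial * (n + p).factorial) := by ring
    _ ≤ |t| ^ n * (t ^ 2) ^ p / (p.factorial * n.factorial) := by gcongr
    _ = _ := by field_simp

lemma bes_hasSum (n : ℕ) (t : ℝ) : HasSum (fun p : ℕ =>
    ((-1) ^ p / ((Nat.factorial p : ℝ) * (Nat.factorial (n + p) : ℝ))) *
    (2 * t / 2) ^ (n + 2 * p)) (besselJR n (2 * t)) := by
  apply Summable.hasSum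
  exact Summable.of_norm_bounded ((Real.summable_pow_div_factorial (t ^ 2)).mul_left _)
    (term_bound n · t)

lemma bes_bound (n : ℕ) (t : ℝ) :
    |besselJR n (2 * t)| ≤ |t| ^ n / n.factorial * Real.exp (t ^ 2) := by
  have h : HasSum (fun p : ℕ => (t ^ 2) ^ p / (p.factorial : ℝ)) (Real.exp (t ^ 2)) := by
    rw [Real.exp_eq_exp_ℝ]; exact NormedSpace.expSeries_div_hasSum_exp _
  exact tsum_of_norm_bounded (h.mul_left _) (term_bound n · t)

lemma key_term (t : ℝ) (m p : ℕ) :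
    ((((-1) ^ p / ((Nat.factorial p : ℝ) * (Nat.factorial (m + p) : ℝ))) *
    (2 * t / 2) ^ (m + 2 * p) : ℝ) : ℂ) = (-1) ^ p * t ^ p * t ^ (m + p) /
      ((Nat.factorial p : ℂ) * (Nat.factorial (m + p) : ℂ)) := by
  have h : 2 * t / 2 = t := by ring
  rw [h]; push_cast; ring

lemma key_hs (t : ℝ) (m : ℕ) (u : ℂ) : HasSum (fun p : ℕ => 
    (-1) ^ p * (t : ℂ) ^ p * t ^ (m + p) /
      ((Nat.factorial p : ℂ) * (Nat.factorial (m + p) : ℂ)) * u) (besselJR m (2 * t) * u) := by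
  have h := ((Complex.hasSum_ofReal (f := _)).2 (bes_hasSum m t)).mul_right u
  simp only [key_term] at h
  exact h

lemma zE_pos (m p : ℕ) : zEquiv ((m : ℤ), p) = (m + p, p) := by
  ext <;> simp [zEquiv]; omega

lemma zE_neg (m p : ℕ) : zEquiv (-(m : ℤ), p) = (p, m + p) := by
  ext <;> simp [zEquiv]; omega

lemma prod_aux (f g : ℕ → ℂ) (a b : ℂ) (hf : HasSum f a) (hg : HasSum g b) :
    HasSum (fun q : ℕ × ℕ => f q.1 * g q.2) (a * b) :=
  hf.mul hg (summable_mul_of_summable_norm hf.summable.norm hg.summable.norm)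

lemma gen_prod (t : ℝ) (w : ℂ) :
    HasSum (fun q : ℕ × ℕ => ((t * w) ^ q.1 / (q.1.factorial : ℂ)) *
      ((-t * w⁻¹) ^ q.2 / (q.2.factorial : ℂ)))
      (Complex.exp (t * w) * Complex.exp (-t * w⁻¹)) :=
  prod_aux (fun n : ℕ => (t * w) ^ n / (n.factorial : ℂ))
    (fun n : ℕ => (-t * w⁻¹) ^ n / (n.factorial : ℂ)) _ _ (exp_hs _) (exp_hs _)

lemma gen_fib (f : ℕ × ℕ → ℂ) (a : ℂ) (hf : HasSum f a) (g : ℤ → ℂ)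
    (h : ∀ n, HasSum (fun p => f (zEquiv (n, p))) (g n)) : HasSum g a := by
  rw [← zEquiv.hasSum_iff] at hf
  exact HasSum.prod_fiberwise hf h

lemma gen_int (t : ℝ) (w : ℂ) (hw : w ≠ 0) :
    HasSum (fun n : ℤ => if 0 ≤ n then (besselJR n.toNat (2 * t) : ℂ) * w ^ n.toNat
      else (besselJR (-n).toNat (2 * t) : ℂ) * (-w⁻¹) ^ (-n).toNat)
      (Complex.exp (t * w) * Complex.exp (-t * w⁻¹)) := by
  apply gen_fib _ _ (gen_prod t w)
  intro n
  by_cases hn : 0 ≤ n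
  · rw [if_pos hn]
    obtain ⟨m, rfl⟩ := Int.eq_ofNat_of_zero_le hn
    have hb := key_hs t m (w ^ m)
    rw [Int.toNat_natCast]
    refine hs_congrC ?_ hb
    intro p
    rw [zE_pos]
    dsimp only
    rw [mul_pow, mul_pow, neg_pow (t : ℂ), inv_pow, pow_add w]
    have : w ^ p ≠ 0 := pow_ne_zero _ hw
    field_simp
  · rw [if_neg hn]
    obtain ⟨m, hm⟩ := Int.eq_ofNat_of_zero_le (a := -n) (by omega)
    obtain rfl : n = -m := by omega
    have hb := key_hs t m ((-w⁻¹) ^ m)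
    rw [neg_neg, Int.toNat_natCast]
    refine hs_congrC ?_ hb
    intro p
    rw [zE_neg]
    dsimp only
    rw [neg_mul, ← mul_neg, mul_pow, mul_pow, pow_add (-w⁻¹),
      neg_pow w⁻¹ p, inv_pow]
    have : w ^ p ≠ 0 := pow_ne_zero _ hw
    field_simp

lemma gen_nat (t φ : ℝ) :
    HasSum (fun n : ℕ => (besselJR n (2 * t) : ℂ) * 
      ((1 + (-1) ^ n) * Real.cos (n * φ) + (1 - (-1) ^ n) * Real.sin (n * φ) * Complex.I))
      (Complex.exp ((2 * t * Real.sin φ : ℝ) * Complex.I) + besselJR 0 (2 * t)) := by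
  have hw := Complex.exp_ne_zero (φ * Complex.I)
  have h := (gen_int t _ hw).nat_add_neg
  have hexp : Complex.exp (t * Complex.exp (φ * Complex.I)) *
      Complex.exp (-t * (Complex.exp (φ * Complex.I))⁻¹)
      = Complex.exp ((2 * t * Real.sin φ : ℝ) * Complex.I) := by
    rw [← Complex.exp_add, ← Complex.exp_neg, ← neg_mul, Complex.exp_mul_I, Complex.exp_mul_I,
      Complex.cos_neg, Complex.sin_neg]
    push_cast; ring_nf
  rw [hexp] at h
  convert h using 2 with n
  · have e1 : Complex.exp (φ * Complex.I) ^ n = Real.cos (n * φ) + Real.sin (n * φ) * Complex.I := by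
      rw [← Complex.exp_nat_mul, ← mul_assoc, Complex.exp_mul_I]; push_cast; rfl
    have e2 : (-(Complex.exp (φ * Complex.I))⁻¹) ^ n = 
        (-1) ^ n * (Real.cos (n * φ) - Real.sin (n * φ) * Complex.I) := by
      rw [neg_pow, ← Complex.exp_neg, ← Complex.exp_nat_mul, ← neg_mul, ← mul_assoc,
       Complex.exp_mul_I]; push_cast; simp [sub_eq_add_neg]
    rcases Nat.eq_zero_or_pos n with rfl | hn
    · simp; ring
    · rw [if_pos (by omega), if_neg (by omega), neg_neg, Int.toNat_natCast, e1, e2]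
      ring
  · simp

lemma gen_cos (t φ : ℝ) :
    HasSum (fun n : ℕ => besselJR n (2 * t) * (1 + (-1) ^ n) * Real.cos (n * φ))
      (Real.cos (2 * t * Real.sin φ) + besselJR 0 (2 * t)) := by
  have h := Complex.hasSum_re (gen_nat t φ)
  convert h using 2 with n
  · have : ((-1 : ℂ) ^ n) = (((-1 : ℝ) ^ n : ℝ) : ℂ) := by push_cast; rfl
    rw [this]
    generalize (-1 : ℝ) ^ n = s
    rw [Complex.re_ofReal_mul]
    rw [← Complex.ofReal_one, ← Complex.ofReal_add, ← Complex.ofReal_sub,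
      ← Complex.ofReal_mul, ← Complex.ofReal_mul]
    simp [-Complex.ofReal_cos, -Complex.ofReal_sin]
    ring
  · rw [Complex.add_re, Complex.exp_ofReal_mul_I_re, Complex.ofReal_re]

lemma gen_sin (t φ : ℝ) :
    HasSum (fun n : ℕ => besselJR n (2 * t) * (1 - (-1) ^ n) * Real.sin (n * φ))
      (Real.sin (2 * t * Real.sin φ)) := by
  have h := Complex.hasSum_im (gen_nat t φ)
  convert h using 2 with n
  · have : ((-1 : ℂ) ^ n) = (((-1 : ℝ) ^ n : ℝ) : ℂ) := by push_cast; rfl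
    rw [this]
    generalize (-1 : ℝ) ^ n = s
    rw [Complex.im_ofReal_mul]
    rw [← Complex.ofReal_one, ← Complex.ofReal_add, ← Complex.ofReal_sub,
      ← Complex.ofReal_mul, ← Complex.ofReal_mul]
    simp [-Complex.ofReal_cos, -Complex.ofReal_sin]
    ring
  · rw [Complex.add_im, Complex.exp_ofReal_mul_I_im, Complex.ofReal_im, add_zero]
noncomputable def QQ (θ : ℝ) : ℕ → ℝ → ℝ
  | 0, _ => 0
  | 1, _ => 1
  | (n + 2), φ => 2 * Real.cos θ * QQ θ (n + 1) φ - QQ θ n φ + 2 * Real.cos ((n + 1) * φ)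

lemma QQ_cont (θ : ℝ) (n : ℕ) : Continuous (QQ θ n) := by
  induction n using Nat.twoStepInduction with
  | zero => exact continuous_const
  | one => exact continuous_const
  | more n h1 h2 =>
    have : QQ θ (n + 2) = fun φ =>
      2 * Real.cos θ * QQ θ (n + 1) φ - QQ θ n φ + 2 * Real.cos ((n + 1) * φ) := by
      funext φ; rw [QQ]
    rw [this]; fun_prop

lemma trig_rec (n : ℕ) (x : ℝ) : Real.cos ((n + 2 : ℕ) * x) =
    2 * Real.cos x * Real.cos ((n + 1) * x) - Real.cos (n * x) := by
  have e1 : ((n + 2 : ℕ) : ℝ) * x = (n + 1) * x + x := by push_cast; ring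
  have e2 : (n : ℝ) * x = (n + 1) * x - x := by ring
  rw [e1, e2, Real.cos_add, Real.cos_sub]; ring

lemma trig_rec_sin (n : ℕ) (x : ℝ) : Real.sin ((n + 2 : ℕ) * x) =
    2 * Real.cos x * Real.sin ((n + 1 : ℕ) * x) - Real.sin (n * x) := by
  have e1 : ((n + 2 : ℕ) : ℝ) * x = (n + 1 : ℕ) * x + x := by push_cast; ring
  have e2 : (n : ℝ) * x = (n + 1 : ℕ) * x - x := by push_cast; ring
  rw [e1, e2, Real.sin_add, Real.sin_sub]; ring

lemma QQ_mul (θ φ : ℝ) (n : ℕ) :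
    QQ θ n φ * (Real.cos φ - Real.cos θ) = Real.cos (n * φ) - Real.cos (n * θ) := by
  induction n using Nat.twoStepInduction with
  | zero => simp [QQ]
  | one => simp [QQ]
  | more n h1 h2 =>
    rw [trig_rec, trig_rec, QQ]
    push_cast at h1 h2
    linear_combination 2 * Real.cos θ * h2 - h1

lemma QQ_bound (θ φ : ℝ) (n : ℕ) : |QQ θ n φ| ≤ 3 ^ n := by
  induction n using Nat.twoStepInduction with
  | zero => simp [QQ]
  | one => simp [QQ]
  | more n h1 h2 =>
    rw [QQ]
    have h0 : (1 : ℝ) ≤ 3 ^ n := one_le_pow₀ (by norm_num)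
    have a1 : |2 * Real.cos θ * QQ θ (n + 1) φ| ≤ 2 * 3 ^ (n + 1) := by
      rw [abs_mul, abs_mul, abs_two]
      have := Real.abs_cos_le_one θ
      have h5 : (0:ℝ) < 3 ^ (n+1) := by positivity
      nlinarith [abs_nonneg (QQ θ (n + 1) φ), abs_nonneg (Real.cos θ)]
    have a3 := Real.abs_cos_le_one ((n + 1) * φ)
    rw [abs_le] at *
    rw [pow_succ] at *
    rw [pow_succ]
    constructor <;> linarith [a1.1, a1.2, h1.1, h1.2, a3.1, a3.2]

lemma QQ_int (θ : ℝ) (hs : Real.sin θ ≠ 0) (n : ℕ) :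
    ∫ φ in (0:ℝ)..Real.pi, QQ θ n φ = Real.pi * Real.sin (n * θ) / Real.sin θ := by
  induction n using Nat.twoStepInduction with
  | zero => simp [QQ]
  | one => simp [QQ]; field_simp
  | more n h1 h2 =>
    have c : ∫ φ in (0:ℝ)..Real.pi, Real.cos ((n + 1) * φ) = 0 := by
      have hn : (n : ℝ) + 1 ≠ 0 := by positivity
      rw [intervalIntegral.integral_comp_mul_left _ hn, integral_cos]
      have := Real.sin_nat_mul_pi (n + 1)
      push_cast at this
      simp [this]
    have i1 : IntervalIntegrable (fun φ => 2 * Real.cos θ * QQ θ (n + 1) φ) volume 0 Real.pi :=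
      ((QQ_cont θ (n+1)).const_mul _).intervalIntegrable _ _ 
    have i2 : IntervalIntegrable (QQ θ n) volume 0 Real.pi :=
      (QQ_cont θ n).intervalIntegrable _ _ 
    have i3 : IntervalIntegrable (fun φ => 2 * Real.cos ((n + 1) * φ)) volume 0 Real.pi := by
      apply Continuous.intervalIntegrable; fun_prop
    have e : ∀ φ, QQ θ (n + 2) φ =
      2 * Real.cos θ * QQ θ (n + 1) φ - QQ θ n φ + 2 * Real.cos ((n + 1) * φ) := by
      intro φ; rw [QQ]
    simp_rw [e]
    rw [intervalIntegral.integral_add (i1.sub i2) i3, intervalIntegral.integral_sub i1 i2,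
      intervalIntegral.integral_const_mul, intervalIntegral.integral_const_mul, c, h1, h2,
      trig_rec_sin]
    field_simp
    ring

lemma inv_int (θ a b : ℝ) (hs : Real.sin θ ≠ 0) (hab : a ≤ b)
    (h : ∀ φ ∈ Set.Icc a b, Real.sin ((φ - θ) / 2) ≠ 0 ∧ Real.sin ((φ + θ) / 2) ≠ 0) :
    IntegrableOn (fun φ => 1 / (Real.cos θ - Real.cos φ)) (Set.Icc a b) ∧
    ∫ φ in Set.Icc a b, 1 / (Real.cos θ - Real.cos φ) = 
     ((Real.log (Real.sin ((b - θ) / 2)) - Real.log (Real.sin ((b + θ) / 2))) -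
     (Real.log (Real.sin ((a - θ) / 2)) - Real.log (Real.sin ((a + θ) / 2)))) / Real.sin θ := by
  have hp : ∀ φ, Real.cos θ - Real.cos φ = 
      2 * (Real.sin ((φ - θ) / 2) * Real.sin ((φ + θ) / 2)) := by
    intro φ
    rw [Real.cos_sub_cos, ← neg_sub φ θ, neg_div, Real.sin_neg, add_comm θ φ]; ring
  have hne : ∀ φ ∈ Set.Icc a b, Real.cos θ - Real.cos φ ≠ 0 := by
    intro φ hφ
    rw [hp]
    have := h φ hφ
    exact mul_ne_zero two_ne_zero (mul_ne_zero this.1 this.2)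
  have hc : ContinuousOn (fun φ => 1 / (Real.cos θ - Real.cos φ)) (Set.Icc a b) :=
    ContinuousOn.div (by fun_prop) (by fun_prop) hne
  refine ⟨hc.integrableOn_Icc, ?_⟩
  rw [integral_Icc_eq_integral_Ioc, ← intervalIntegral.integral_of_le hab]
  rw [intervalIntegral.integral_eq_sub_of_hasDerivAt (f := fun φ => 
     (Real.log (Real.sin ((φ - θ) / 2)) - Real.log (Real.sin ((φ + θ) / 2))) / Real.sin θ)]
  · ring
  · intro φ hφ
    rw [Set.uIcc_of_le hab] at hφ
    obtain ⟨h1, h2⟩ := h φ hφ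
    have d1 : HasDerivAt (fun φ : ℝ => (φ - θ) / 2) (1 / 2) φ := 
      ((hasDerivAt_id φ).sub_const θ).div_const 2
    have d2 : HasDerivAt (fun φ : ℝ => (φ + θ) / 2) (1 / 2) φ := 
      ((hasDerivAt_id φ).add_const θ).div_const 2
    have := (((d1.sin).log h1).sub ((d2.sin).log h2)).div_const (Real.sin θ)
    refine this.congr_deriv ?_
    have hh : Real.sin θ = Real.sin ((φ + θ) / 2) * Real.cos ((φ - θ) / 2) -
        Real.cos ((φ + θ) / 2) * Real.sin ((φ - θ) / 2) := by
      rw [← Real.sin_sub]; ring_nf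
    rw [hp]
    field_simp
    linear_combination -hh
  · rw [intervalIntegrable_iff_integrableOn_Icc_of_le hab]
    exact hc.integrableOn_Icc

lemma piece (θ : ℝ) (hθ : θ ∈ Set.Ioo 0 Real.pi) (g H : ℝ → ℝ) (hH : Continuous H)
    (hg : ∀ φ, H φ * (Real.cos φ - Real.cos θ) = g φ - g θ) (a b : ℝ) (ha : 0 ≤ a)
    (hb : b ≤ Real.pi) (hab : a ≤ b) (hn : θ ∉ Set.Icc a b) :
    IntegrableOn (fun φ => g φ / (Real.cos θ - Real.cos φ)) (Set.Icc a b) ∧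
    ∫ φ in Set.Icc a b, g φ / (Real.cos θ - Real.cos φ) = 
     g θ * (((Real.log (Real.sin ((b - θ) / 2)) - Real.log (Real.sin ((b + θ) / 2))) -
     (Real.log (Real.sin ((a - θ) / 2)) - Real.log (Real.sin ((a + θ) / 2)))) / Real.sin θ)
      - ((∫ φ in (0:ℝ)..b, H φ) - ∫ φ in (0:ℝ)..a, H φ) := by
  obtain ⟨h0, h1⟩ := hθ
  have hs : Real.sin θ ≠ 0 := (Real.sin_pos_of_pos_of_lt_pi h0 h1).ne'
  have hne : ∀ φ ∈ Set.Icc a b, φ ≠ θ := fun φ hφ h => hn (h ▸ hφ)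
  obtain ⟨i1, e1⟩ := inv_int θ a b hs hab (by
    intro φ hφ
    have := hne φ hφ
    obtain ⟨h2, h3⟩ := hφ
    constructor
    · intro h
      rw [Real.sin_eq_zero_iff_of_lt_of_lt (by linarith) (by linarith)] at h
      exact this (by linarith)
    · exact (Real.sin_pos_of_pos_of_lt_pi (by linarith) (by linarith)).ne')
  have hcongr : Set.EqOn (fun φ => g θ * (1 / (Real.cos θ - Real.cos φ)) - H φ)
      (fun φ => g φ / (Real.cos θ - Real.cos φ)) (Set.Icc a b) := by
    intro φ hφ
    have : Real.cos θ - Real.cos φ ≠ 0 := by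
      intro h
      exact hne φ hφ (Real.injOn_cos ⟨ha.trans hφ.1, hφ.2.trans hb⟩ ⟨h0.le, h1.le⟩ (by linarith))
    have h2 := hg φ
    dsimp only
    field_simp
    linear_combination h2
  have iH : IntegrableOn H (Set.Icc a b) := hH.continuousOn.integrableOn_Icc
  have i2 : IntegrableOn (fun φ => g θ * (1 / (Real.cos θ - Real.cos φ)) - H φ) (Set.Icc a b) :=
    (i1.const_mul (g θ)).sub iH
  refine ⟨i2.congr_fun hcongr measurableSet_Icc, ?_⟩
  rw [← setIntegral_congr_fun measurableSet_Icc hcongr, integral_sub (i1.const_mul (g θ)) iH,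
    integral_const_mul, e1, intervalIntegral.integral_interval_sub_left
      (hH.intervalIntegrable _ _) (hH.intervalIntegrable _ _), integral_Icc_eq_integral_Ioc,
      intervalIntegral.integral_of_le hab]

lemma pv_lim (θ : ℝ) (hθ : θ ∈ Set.Ioo 0 Real.pi) (g H : ℝ → ℝ) (hH : Continuous H)
    (hg : ∀ φ, H φ * (Real.cos φ - Real.cos θ) = g φ - g θ) :
    Tendsto (fun ε : ℝ => ∫ φ in Set.Icc 0 Real.pi \ Set.Ioo (θ - ε) (θ + ε),
      g φ / (Real.cos θ - Real.cos φ)) (nhdsWithin 0 (Set.Ioi 0))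
      (nhds (-∫ φ in (0:ℝ)..Real.pi, H φ)) := by
  have hP := intervalIntegral.continuous_primitive (μ := volume) (f := H) (fun a b => hH.intervalIntegrable a b) 0
  have hs : 0 < Real.sin θ := (Real.sin_pos_of_pos_of_lt_pi hθ.1 hθ.2)
  set P : ℝ → ℝ := fun x => ∫ φ in (0:ℝ)..x, H φ with hPdef
  have hev : ∀ᶠ ε in nhdsWithin (0:ℝ) (Set.Ioi 0),
      g θ * ((Real.log (Real.sin (θ + ε / 2)) - Real.log (Real.sin (θ - ε / 2))) / Real.sin θ)
        - (P (θ - ε) + (P Real.pi - P (θ + ε))) =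
      ∫ φ in Set.Icc 0 Real.pi \ Set.Ioo (θ - ε) (θ + ε), g φ / (Real.cos θ - Real.cos φ) := by
    have hm : 0 < min θ (Real.pi - θ) := lt_min hθ.1 (by linarith [hθ.2])
    filter_upwards [Ioo_mem_nhdsGT hm] with ε hε
    obtain ⟨e0, e1⟩ := hε
    obtain ⟨e1, e2⟩ := lt_min_iff.1 e1
    have hset : Set.Icc 0 Real.pi \ Set.Ioo (θ - ε) (θ + ε) =
        Set.Icc 0 (θ - ε) ∪ Set.Icc (θ + ε) Real.pi := by
      ext x
      simp only [Set.mem_sdiff, Set.mem_Icc, Set.mem_Ioo, Set.mem_union, not_and_or, not_lt]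
      constructor
      · rintro ⟨⟨h1, h2⟩, h3 | h3⟩
        · exact Or.inl ⟨h1, h3⟩
        · exact Or.inr ⟨h3, h2⟩
      · rintro (⟨h1, h2⟩ | ⟨h1, h2⟩)
        · exact ⟨⟨h1, by linarith⟩, Or.inl h2⟩
        · exact ⟨⟨by linarith, h2⟩, Or.inr h1⟩
    have hdis : Disjoint (Set.Icc 0 (θ - ε)) (Set.Icc (θ + ε) Real.pi) := by
      rw [Set.disjoint_left]
      intro x hx hx'
      linarith [hx.2, hx'.1]
    obtain ⟨i1, v1⟩ := piece θ hθ g H hH hg 0 (θ - ε) le_rfl (by linarith) (by linarith)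
      (fun h => by linarith [h.2])
    obtain ⟨i2, v2⟩ := piece θ hθ g H hH hg (θ + ε) Real.pi (by linarith) le_rfl (by linarith)
      (fun h => by linarith [h.1])
    rw [hset, setIntegral_union hdis measurableSet_Icc i1 i2, v1, v2]
    have a1 : (θ - ε - θ) / 2 = -(ε / 2) := by ring
    have a2 : (θ - ε + θ) / 2 = θ - ε / 2 := by ring
    have a3 : (θ + ε - θ) / 2 = ε / 2 := by ring
    have a4 : (θ + ε + θ) / 2 = θ + ε / 2 := by ring
    have a5 : (0 - θ) / 2 = -(θ / 2) := by ring
    have a6 : (0 + θ) / 2 = θ / 2 := by ring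
    have a7 : (Real.pi + θ) / 2 = Real.pi - (Real.pi - θ) / 2 := by ring
    rw [a1, a2, a3, a4, a5, a6, a7, Real.sin_pi_sub, Real.sin_neg, Real.sin_neg,
      Real.log_neg_eq_log, Real.log_neg_eq_log, intervalIntegral.integral_same]
    ring
  refine Tendsto.congr' hev ?_
  have hc : ContinuousAt (fun ε => g θ * ((Real.log (Real.sin (θ + ε / 2)) -
      Real.log (Real.sin (θ - ε / 2))) / Real.sin θ)
        - (P (θ - ε) + (P Real.pi - P (θ + ε)))) 0 := by
    have c1 : ContinuousAt (fun ε : ℝ => Real.log (Real.sin (θ + ε / 2))) 0 := by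
      apply ContinuousAt.log (by fun_prop); simpa using hs.ne'
    have c2 : ContinuousAt (fun ε : ℝ => Real.log (Real.sin (θ - ε / 2))) 0 := by
      apply ContinuousAt.log (by fun_prop); simpa using hs.ne'
    have c3 : Continuous (fun ε : ℝ => (P (θ - ε) + (P Real.pi - P (θ + ε)))) := by
      fun_prop
    exact (continuousAt_const.mul ((c1.sub c2).div_const _)).sub c3.continuousAt
  have := hc.tendsto.mono_left (nhdsWithin_le_nhds (s := Set.Ioi 0))
  convert this using 2
  simp [hPdef]

lemma coeff_summable (t : ℝ) :
    Summable (fun n : ℕ => |besselJR n (2 * t) * (1 + (-1) ^ n)| * 3 ^ n) := by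
  refine Summable.of_nonneg_of_le (fun n => by positivity) (fun n => ?_)
    ((Real.summable_pow_div_factorial (|t| * 3)).mul_left (2 * Real.exp (t ^ 2)))
  have h := bes_bound n t
  have h2 : |1 + (-1 : ℝ) ^ n| ≤ 2 := by
    rcases neg_one_pow_eq_or ℝ n with h | h <;> rw [h] <;> norm_num
  rw [abs_mul, mul_pow]
  calc _ ≤ (|t| ^ n / n.factorial * Real.exp (t ^ 2)) * 2 * 3 ^ n := by gcongr
    _ = _ := by ring

lemma H_exists (t θ : ℝ) (hs : Real.sin θ ≠ 0) : ∃ H : ℝ → ℝ, Continuous H ∧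
    (∀ φ, H φ * (Real.cos φ - Real.cos θ) =
      Real.cos (2 * t * Real.sin φ) - Real.cos (2 * t * Real.sin θ)) ∧
    HasSum (fun n : ℕ => besselJR n (2 * t) * (1 + (-1) ^ n) *
      (Real.pi * Real.sin (n * θ) / Real.sin θ)) (∫ φ in (0:ℝ)..Real.pi, H φ) := by
  have hb : ∀ (n : ℕ) (φ : ℝ), ‖besselJR n (2 * t) * (1 + (-1) ^ n) * QQ θ n φ‖ ≤
      |besselJR n (2 * t) * (1 + (-1) ^ n)| * 3 ^ n := by
    intro n φ
    rw [norm_mul, Real.norm_eq_abs, Real.norm_eq_abs]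
    gcongr
    exact QQ_bound θ φ n
  have hsum := coeff_summable t
  have hcont : ∀ n : ℕ, Continuous fun φ => besselJR n (2 * t) * (1 + (-1) ^ n) * QQ θ n φ :=
    fun n => (QQ_cont θ n).const_mul _
  have hHS : ∀ φ, HasSum (fun n : ℕ => besselJR n (2 * t) * (1 + (-1) ^ n) * QQ θ n φ)
      (∑' n : ℕ, besselJR n (2 * t) * (1 + (-1) ^ n) * QQ θ n φ) := fun φ =>
    (Summable.of_norm_bounded hsum (hb · φ)).hasSum
  refine ⟨fun φ => ∑' n : ℕ, besselJR n (2 * t) * (1 + (-1) ^ n) * QQ θ n φ,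
    continuous_tsum hcont hsum hb, fun φ => ?_, ?_⟩
  · have h1 := (hHS φ).mul_right (Real.cos φ - Real.cos θ)
    have h2 := (gen_cos t φ).sub (gen_cos t θ)
    rw [add_sub_add_right_eq_sub] at h2
    refine h1.unique (hs_congrR (fun n => ?_) h2)
    rw [mul_assoc _ (QQ θ n φ), QQ_mul]; ring
  · have h := intervalIntegral.hasSum_integral_of_dominated_convergence (μ := volume)
      (a := 0) (b := Real.pi)
      (F := fun (n : ℕ) φ => besselJR n (2 * t) * (1 + (-1) ^ n) * QQ θ n φ)
      (fun n _ => |besselJR n (2 * t) * (1 + (-1) ^ n)| * 3 ^ n)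
      (fun n => (hcont n).aestronglyMeasurable)
      (fun n => Eventually.of_forall fun φ _ => hb n φ)
      (Eventually.of_forall fun φ _ => hsum)
      intervalIntegrable_const
      (Eventually.of_forall fun φ _ => hHS φ)
    refine hs_congrR (fun n => ?_) h
    rw [intervalIntegral.integral_const_mul, QQ_int θ hs]

/-- for every real `t` and `θ ∈ (0,π)`,
`Σ_{m≥1} (-1)^m J_m(2t) sin(mθ)
  = -sin(2t sinθ)/2 - (sinθ/(2π)) p.v.∫₀^π cos(2t sinφ)/(cosθ - cosφ) dφ`,
the principal value integral being the limit as `ε → 0⁺` of the integral over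
`[0,π] ∖ (θ-ε, θ+ε)`; in particular this principal value limit exists. -/
theorem statement_10 (t θ : ℝ) (hθ : θ ∈ Set.Ioo 0 Real.pi) :
    Tendsto
      (fun ε : ℝ =>
        -Real.sin (2 * t * Real.sin θ) / 2 -
          Real.sin θ / (2 * Real.pi) *
            ∫ φ in Set.Icc 0 Real.pi \ Set.Ioo (θ - ε) (θ + ε),
              Real.cos (2 * t * Real.sin φ) / (Real.cos θ - Real.cos φ))
      (nhdsWithin 0 (Set.Ioi 0))
      (nhds (∑' m : ℕ, (-1) ^ (m + 1) * besselJR (m + 1) (2 * t) *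
        Real.sin ((m + 1) * θ))) := by
  have hs : Real.sin θ ≠ 0 := (Real.sin_pos_of_pos_of_lt_pi hθ.1 hθ.2).ne'
  obtain ⟨H, hH, hg, hsum⟩ := H_exists t θ hs
  have hl := pv_lim θ hθ (fun φ => Real.cos (2 * t * Real.sin φ)) H hH hg
  have hl2 := (hl.const_mul (Real.sin θ / (2 * Real.pi))).const_sub
    (-Real.sin (2 * t * Real.sin θ) / 2)
  convert hl2 using 2
  have h1 := (hsum.mul_left (Real.sin θ / (2 * Real.pi))).sub ((gen_sin t θ).div_const 2)
  have h2 : HasSum (fun n : ℕ => (-1) ^ n * besselJR n (2 * t) * Real.sin (n * θ))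
      (-Real.sin (2 * t * Real.sin θ) / 2 -
        Real.sin θ / (2 * Real.pi) * -∫ φ in (0:ℝ)..Real.pi, H φ) := by
    have e : -Real.sin (2 * t * Real.sin θ) / 2 -
        Real.sin θ / (2 * Real.pi) * -∫ φ in (0:ℝ)..Real.pi, H φ =
        Real.sin θ / (2 * Real.pi) * (∫ φ in (0:ℝ)..Real.pi, H φ) -
          Real.sin (2 * t * Real.sin θ) / 2 := by ring
    rw [e]
    refine hs_congrR (fun n => ?_) h1
    have := Real.pi_ne_zero
    field_simp
    ring
  rw [← hasSum_nat_add_iff' 1] at h2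
  simp only [Finset.sum_range_one, Nat.cast_zero, zero_mul, Real.sin_zero, mul_zero,
    sub_zero, Nat.cast_add, Nat.cast_one] at h2
  exact h2.tsum_eq
end

section
/- For all m,n ∈ ℕ and t ∈ ℂ: I²_{m,n}(t) = (−1)^m I²_{0,m+n}(t) = (−1)^n I²_{m+n,0}(t); moreover I²_{0,n}(t) = 0 when n is odd, and for n = 2j, I²_{0,2j}(t) = ((−it)^j / j!) · ₁F₁(j + 1/2; 2j + 2; 4it), where ₁F₁(a; b; z) := Σ_{k≥0} ((a)_k/(b)_k)·z^k/k! is the confluent hypergeometric function, (a)_k denoting the ascending Pochhammer symbol a(a+1)⋯(a+k−1). -/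
/-- The coefficients `I²_{m,n}(t)`: zero if `m+n` is odd, and
`(-1)^{(3m+n)/2} Σ_{p≥0} (it)^{(m+n)/2+p}/((m+n)/2+p)! · (m+n+1)/(2p+m+n+1) · C(2p+m+n+1,p)`
if `m+n` is even. -/
noncomputable def I2coef (m n : ℕ) (t : ℂ) : ℂ :=
  if (m + n) % 2 = 1 then 0
  else
    (-1) ^ ((3 * m + n) / 2) *
      ∑' p : ℕ,
        (Complex.I * t) ^ ((m + n) / 2 + p) / (Nat.factorial ((m + n) / 2 + p) : ℂ) *
          (((m : ℂ) + n + 1) / (2 * (p : ℂ) + m + n + 1)) *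
          (Nat.choose (2 * p + m + n + 1) p : ℂ)

/-- The confluent hypergeometric function
`₁F₁(a; b; z) = Σ_{k≥0} ((a)_k/(b)_k) z^k/k!` (ascending Pochhammer symbols). -/
noncomputable def hyp1F1 (a b z : ℂ) : ℂ :=
  ∑' k : ℕ,
    (Polynomial.eval a (ascPochhammer ℂ k) / Polynomial.eval b (ascPochhammer ℂ k)) *
      z ^ k / (Nat.factorial k : ℂ)

theorem asc_A (j p : ℕ) :
    Polynomial.eval (2 * (j : ℂ) + 2) (ascPochhammer ℂ p) * (Nat.factorial (2 * j + 1) : ℂ) =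
      (Nat.factorial (p + (2 * j + 1)) : ℂ) := by
  induction p with
  | zero => simp
  | succ p ih =>
    rw [ascPochhammer_succ_eval, show p + 1 + (2 * j + 1) = (p + (2 * j + 1)) + 1 by ring,
      Nat.factorial_succ (p + (2 * j + 1)), Nat.cast_mul, ← ih]
    push_cast
    ring

theorem asc_B (j p : ℕ) :
    Polynomial.eval ((j : ℂ) + 1 / 2) (ascPochhammer ℂ p) * 4 ^ p *
      (Nat.factorial (j + p) : ℂ) * (Nat.factorial (2 * j) : ℂ) =
      (Nat.factorial (2 * p + 2 * j) : ℂ) * (Nat.factorial j : ℂ) := by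
  induction p with
  | zero => simp; ring
  | succ p ih =>
    rw [ascPochhammer_succ_eval, show 2 * (p + 1) + 2 * j = (2 * p + 2 * j) + 1 + 1 by ring,
      Nat.factorial_succ, Nat.factorial_succ, ← add_assoc j p 1, Nat.factorial_succ (j + p)]
    push_cast
    linear_combination ((2 * p + 2 * j + 1) * (2 * p + 2 * j + 2) : ℂ) * ih

theorem term_eq (j p : ℕ) (z : ℂ) :
    z ^ (j + p) / (Nat.factorial (j + p) : ℂ) *
          ((2 * (j : ℂ) + 1) / (2 * (p : ℂ) + 2 * j + 1)) *
          (Nat.choose (2 * p + 2 * j + 1) p : ℂ) =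
    z ^ j / (Nat.factorial j : ℂ) *
     ((Polynomial.eval ((j : ℂ) + 1 / 2) (ascPochhammer ℂ p) /
       Polynomial.eval (2 * (j : ℂ) + 2) (ascPochhammer ℂ p)) *
      (4 * z) ^ p / (Nat.factorial p : ℂ)) := by
  have hA := asc_A j p
  have hB := asc_B j p
  have hC : (Nat.choose (2 * p + 2 * j + 1) p : ℂ) * (Nat.factorial p : ℂ) *
      (Nat.factorial (p + (2 * j + 1)) : ℂ) =
      (2 * p + 2 * j + 1) * (Nat.factorial (2 * p + 2 * j) : ℂ) := by
    have h := Nat.choose_mul_factorial_mul_factorial (show p ≤ 2 * p + 2 * j + 1 by omega)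
    rw [show 2 * p + 2 * j + 1 - p = p + (2 * j + 1) by omega,
      Nat.factorial_succ (2 * p + 2 * j)] at h
    exact_mod_cast h
  have f (k : ℕ) : (Nat.factorial k : ℂ) ≠ 0 := by exact_mod_cast Nat.factorial_ne_zero k
  have hd : (2 * (p : ℂ) + 2 * j + 1) ≠ 0 := by exact_mod_cast Nat.succ_ne_zero (2 * p + 2 * j)
  have hj : (2 * (j : ℂ) + 1) ≠ 0 := by exact_mod_cast Nat.succ_ne_zero (2 * j)
  have hf : (Nat.factorial (2 * j + 1) : ℂ) = (2 * j + 1) * (Nat.factorial (2 * j) : ℂ) := by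
    rw [Nat.factorial_succ]; push_cast; ring
  have f1 := f p
  have f2 := f j
  have f3 := f (j + p)
  have f4 := f (2 * j)
  have f5 := f (p + (2 * j + 1))
  rw [hf] at hA
  have e1 : Polynomial.eval (2 * (j : ℂ) + 2) (ascPochhammer ℂ p) =
      (Nat.factorial (p + (2 * j + 1)) : ℂ) / ((2 * j + 1) * (Nat.factorial (2 * j) : ℂ)) := by
    rw [eq_div_iff (mul_ne_zero hj f4)]; exact hA
  have e2 : (Nat.choose (2 * p + 2 * j + 1) p : ℂ) =
      (2 * p + 2 * j + 1) * (Nat.factorial (2 * p + 2 * j) : ℂ) /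
       ((Nat.factorial p : ℂ) * (Nat.factorial (p + (2 * j + 1)) : ℂ)) := by
    rw [eq_div_iff (mul_ne_zero f1 f5), ← hC]; ring
  have e3 : Polynomial.eval ((j : ℂ) + 1 / 2) (ascPochhammer ℂ p) =
      (Nat.factorial (2 * p + 2 * j) : ℂ) * (Nat.factorial j : ℂ) /
       (4 ^ p * (Nat.factorial (j + p) : ℂ) * (Nat.factorial (2 * j) : ℂ)) := by
    rw [eq_div_iff (mul_ne_zero (mul_ne_zero (pow_ne_zero p (by norm_num)) f3) f4), ← hB]; ring
  rw [e1, e2, e3, mul_pow, pow_add]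
  generalize (Nat.factorial (p + (2 * j + 1)) : ℂ) = F5 at *
  generalize (Nat.factorial (2 * p + 2 * j) : ℂ) = F6 at *
  generalize (Nat.factorial (j + p) : ℂ) = F3 at *
  generalize (Nat.factorial (2 * j) : ℂ) = F4 at *
  generalize (Nat.factorial p : ℂ) = F1 at *
  generalize (Nat.factorial j : ℂ) = F2 at *
  clear hA hB hC hf e1 e2 e3
  generalize (2 * (p : ℂ) + 2 * j + 1) = D at *
  field_simp

/-- `I²_{m,n}(t) = (-1)^m I²_{0,m+n}(t) = (-1)^n I²_{m+n,0}(t)`,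
`I²_{0,n}(t) = 0` for odd `n`, and `I²_{0,2j}(t) = ((-it)^j/j!) ₁F₁(j+1/2; 2j+2; 4it)`. -/
theorem statement_19 (m n : ℕ) (t : ℂ) :
    I2coef m n t = (-1) ^ m * I2coef 0 (m + n) t ∧
    I2coef m n t = (-1) ^ n * I2coef (m + n) 0 t ∧
    (Odd n → I2coef 0 n t = 0) ∧
    (∀ j : ℕ,
      I2coef 0 (2 * j) t =
        (-(Complex.I * t)) ^ j / (Nat.factorial j : ℂ) *
          hyp1F1 ((j : ℂ) + 1 / 2) (2 * (j : ℂ) + 2) (4 * (Complex.I * t))) := by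
  have key : ∀ a b c d : ℕ, a + b = c + d →
      (∑' p : ℕ, (Complex.I * t) ^ ((a + b) / 2 + p) / (Nat.factorial ((a + b) / 2 + p) : ℂ) *
          (((a : ℂ) + b + 1) / (2 * (p : ℂ) + a + b + 1)) *
          (Nat.choose (2 * p + a + b + 1) p : ℂ)) =
      ∑' p : ℕ, (Complex.I * t) ^ ((c + d) / 2 + p) / (Nat.factorial ((c + d) / 2 + p) : ℂ) *
          (((c : ℂ) + d + 1) / (2 * (p : ℂ) + c + d + 1)) *
          (Nat.choose (2 * p + c + d + 1) p : ℂ) := by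
    intro a b c d h
    have h' : (a : ℂ) + b = c + d := by exact_mod_cast h
    simp only [add_assoc (2 * _) a b, add_assoc (2 * _) c d, add_assoc (2 * _) (a : ℂ) (b : ℂ),
      add_assoc (2 * _) (c : ℂ) (d : ℂ), h, h']
  have par : ∀ a b : ℕ, a % 2 = b % 2 → ((-1 : ℂ)) ^ a = (-1) ^ b := by
    intro a b h
    rw [neg_one_pow_eq_pow_mod_two, h, ← neg_one_pow_eq_pow_mod_two]
  refine ⟨?_, ?_, ?_, ?_⟩
  · unfold I2coef
    rw [zero_add]
    split_ifs with h
    · simp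
    · rw [key m n 0 (m + n) (by simp), ← mul_assoc, ← pow_add,
        par ((3 * m + n) / 2) (m + (3 * 0 + (m + n)) / 2) (by omega), zero_add]
  · unfold I2coef
    rw [add_zero]
    split_ifs with h
    · simp
    · rw [key m n (m + n) 0 (by simp), ← mul_assoc, ← pow_add,
        par ((3 * m + n) / 2) (n + (3 * (m + n) + 0) / 2) (by omega), add_zero (m + n)]
  · intro h
    unfold I2coef
    rw [if_pos (by rw [zero_add]; exact Nat.odd_iff.mp h)]
  · intro j
    unfold I2coef hyp1F1
    rw [if_neg (by omega), neg_pow (Complex.I * t), mul_div_assoc, mul_assoc,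
      show (3 * 0 + 2 * j) / 2 = j by omega]
    congr 1
    rw [← tsum_mul_left]
    apply tsum_congr
    intro p
    rw [← term_eq]
    simp
end
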